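/- arXiv:2107.14671 — 2 statements merged into one kernel-verified Lean document; each statement's English description precedes it below -/
import Mathlib

section
/- Let κ₁, κ₂, κ₃, κ₄ : ℝ² → ℝ be arbitrary functions, let α₁, α₂, α₃ ∈ ℝ, and define κ₅ : ℝ² → ℝ by κ₅ = −((α₁α₃ − α₂²)κ₁ + α₁κ₂ + α₂κ₃ + α₃κ₄). Let u₁, u₂ : ℝ² → ℝ be differentiable and define v₁(x₁, x₂) = u₁(x₁, x₂) + α₁x₁ + α₂x₂ and v₂(x₁, x₂) = u₂(x₁, x₂) + α₂x₁ + α₃x₂. Then at every point x ∈ ℝ²: (i) v₂,₁(x) − v₁,₂(x) = u₂,₁(x) − u₁,₂(x); and (ii) if u₁,₂(x) = u₂,₁(x), then κ₁(v(x))(v₁,₁v₂,₂ − v₁,₂²)(x) + κ₂(v(x))v₁,₁(x) + κ₃(v(x))v₁,₂(x) + κ₄(v(x))v₂,₂(x) + κ₅(v(x)) = κ₁(v(x))(u₁,₁u₂,₂ − u₁,₂²)(x) + (α₃κ₁ + κ₂)(v(x)) u₁,₁(x) + (−2α₂κ₁ + κ₃)(v(x)) u₁,₂(x) + (α₁κ₁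 + κ₄)(v(x)) u₂,₂(x). In particular, u = (u₁, u₂) satisfies the homogeneous system u₂,₁ − u₁,₂ = 0, κ₁(v)(u₁,₁u₂,₂ − u₁,₂²) + (α₃κ₁ + κ₂)(v)u₁,₁ + (−2α₂κ₁ + κ₃)(v)u₁,₂ + (α₁κ₁ + κ₄)(v)u₂,₂ = 0 if and only if v = (v₁, v₂) satisfies the original nonhomogeneous system v₂,₁ − v₁,₂ = 0, κ₁(v)(v₁,₁v₂,₂ − v₁,₂²) + κ₂(v)v₁,₁ + κ₃(v)v₁,₂ + κ₄(v)v₂,₂ + κ₅(v) = 0. -/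
/-- The partial derivative of a scalar function on `ℝⁿ` with respect to `xᵢ`. -/
noncomputable def pdi {n : ℕ} (u : (Fin n → ℝ) → ℝ) (i : Fin n) (x : Fin n → ℝ) : ℝ :=
  fderiv ℝ u x (Pi.single i 1)

/-- The partial derivatives of a function on the plane shift by the coefficients of an added
linear form. -/
theorem pdi_add_linear {u : (Fin 2 → ℝ) → ℝ} (a b : ℝ) (x : Fin 2 → ℝ)
    (hu : DifferentiableAt ℝ u x) (i : Fin 2) :
    pdi (fun y => u y + a * y 0 + b * y 1) i x = pdi u i x + ![a, b] i := by
  have h : HasFDerivAt (fun y : Fin 2 → ℝ => u y + a * y 0 + b * y 1)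
      (fderiv ℝ u x + a • ContinuousLinearMap.proj (R := ℝ) (φ := fun _ : Fin 2 => ℝ) 0 +
        b • ContinuousLinearMap.proj (R := ℝ) (φ := fun _ : Fin 2 => ℝ) 1) x :=
    (hu.hasFDerivAt.add ((hasFDerivAt_apply 0 x).const_mul a)).add
      ((hasFDerivAt_apply 1 x).const_mul b)
  unfold pdi
  rw [h.fderiv]
  fin_cases i <;> simp

/-- The substitution `u₁ → u₁ + α₁x₁ + α₂x₂`, `u₂ → u₂ + α₂x₁ + α₃x₂`
removes the nonhomogeneous term of the first-order Monge–Ampère system in (1+1)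
dimensions when `κ₅ = −((α₁α₃ − α₂²)κ₁ + α₁κ₂ + α₂κ₃ + α₃κ₄)`. -/
theorem stmt_9 (κ₁ κ₂ κ₃ κ₄ κ₅ : (Fin 2 → ℝ) → ℝ) (α₁ α₂ α₃ : ℝ)
    (hκ₅ : κ₅ = fun y =>
      -((α₁ * α₃ - α₂ ^ 2) * κ₁ y + α₁ * κ₂ y + α₂ * κ₃ y + α₃ * κ₄ y))
    (u₁ u₂ : (Fin 2 → ℝ) → ℝ) (hu₁ : Differentiable ℝ u₁) (hu₂ : Differentiable ℝ u₂)
    (v₁ v₂ : (Fin 2 → ℝ) → ℝ)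
    (hv₁ : v₁ = fun x => u₁ x + α₁ * x 0 + α₂ * x 1)
    (hv₂ : v₂ = fun x => u₂ x + α₂ * x 0 + α₃ * x 1) :
    (∀ x : Fin 2 → ℝ,
      (pdi v₂ 0 x - pdi v₁ 1 x = pdi u₂ 0 x - pdi u₁ 1 x) ∧
      (pdi u₁ 1 x = pdi u₂ 0 x →
        κ₁ ![v₁ x, v₂ x] * (pdi v₁ 0 x * pdi v₂ 1 x - (pdi v₁ 1 x) ^ 2) +
          κ₂ ![v₁ x, v₂ x] * pdi v₁ 0 x + κ₃ ![v₁ x, v₂ x] * pdi v₁ 1 x +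
          κ₄ ![v₁ x, v₂ x] * pdi v₂ 1 x + κ₅ ![v₁ x, v₂ x] =
        κ₁ ![v₁ x, v₂ x] * (pdi u₁ 0 x * pdi u₂ 1 x - (pdi u₁ 1 x) ^ 2) +
          (α₃ * κ₁ ![v₁ x, v₂ x] + κ₂ ![v₁ x, v₂ x]) * pdi u₁ 0 x +
          (-2 * α₂ * κ₁ ![v₁ x, v₂ x] + κ₃ ![v₁ x, v₂ x]) * pdi u₁ 1 x +
          (α₁ * κ₁ ![v₁ x, v₂ x] + κ₄ ![v₁ x, v₂ x]) * pdi u₂ 1 x)) ∧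
    ((∀ x : Fin 2 → ℝ,
        pdi u₂ 0 x - pdi u₁ 1 x = 0 ∧
        κ₁ ![v₁ x, v₂ x] * (pdi u₁ 0 x * pdi u₂ 1 x - (pdi u₁ 1 x) ^ 2) +
          (α₃ * κ₁ ![v₁ x, v₂ x] + κ₂ ![v₁ x, v₂ x]) * pdi u₁ 0 x +
          (-2 * α₂ * κ₁ ![v₁ x, v₂ x] + κ₃ ![v₁ x, v₂ x]) * pdi u₁ 1 x +
          (α₁ * κ₁ ![v₁ x, v₂ x] + κ₄ ![v₁ x, v₂ x]) * pdi u₂ 1 x = 0) ↔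
      (∀ x : Fin 2 → ℝ,
        pdi v₂ 0 x - pdi v₁ 1 x = 0 ∧
        κ₁ ![v₁ x, v₂ x] * (pdi v₁ 0 x * pdi v₂ 1 x - (pdi v₁ 1 x) ^ 2) +
          κ₂ ![v₁ x, v₂ x] * pdi v₁ 0 x + κ₃ ![v₁ x, v₂ x] * pdi v₁ 1 x +
          κ₄ ![v₁ x, v₂ x] * pdi v₂ 1 x + κ₅ ![v₁ x, v₂ x] = 0)) := by
  have h₁ (x : Fin 2 → ℝ) (i : Fin 2) : pdi v₁ i x = pdi u₁ i x + ![α₁, α₂] i :=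
    hv₁ ▸ pdi_add_linear α₁ α₂ x (hu₁ x) i
  have h₂ (x : Fin 2 → ℝ) (i : Fin 2) : pdi v₂ i x = pdi u₂ i x + ![α₂, α₃] i :=
    hv₂ ▸ pdi_add_linear α₂ α₃ x (hu₂ x) i
  have key (x : Fin 2 → ℝ) :
      κ₁ ![v₁ x, v₂ x] * (pdi v₁ 0 x * pdi v₂ 1 x - (pdi v₁ 1 x) ^ 2) +
          κ₂ ![v₁ x, v₂ x] * pdi v₁ 0 x + κ₃ ![v₁ x, v₂ x] * pdi v₁ 1 x +
          κ₄ ![v₁ x, v₂ x] * pdi v₂ 1 x + κ₅ ![v₁ x, v₂ x] =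
        κ₁ ![v₁ x, v₂ x] * (pdi u₁ 0 x * pdi u₂ 1 x - (pdi u₁ 1 x) ^ 2) +
          (α₃ * κ₁ ![v₁ x, v₂ x] + κ₂ ![v₁ x, v₂ x]) * pdi u₁ 0 x +
          (-2 * α₂ * κ₁ ![v₁ x, v₂ x] + κ₃ ![v₁ x, v₂ x]) * pdi u₁ 1 x +
          (α₁ * κ₁ ![v₁ x, v₂ x] + κ₄ ![v₁ x, v₂ x]) * pdi u₂ 1 x := by
    simp only [h₁, h₂, hκ₅, Matrix.cons_val_zero, Matrix.cons_val_one]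
    ring
  have curl (x : Fin 2 → ℝ) : pdi v₂ 0 x - pdi v₁ 1 x = pdi u₂ 0 x - pdi u₁ 1 x := by
    simp only [h₁, h₂, Matrix.cons_val_zero, Matrix.cons_val_one]
    ring
  refine ⟨fun x => ⟨curl x, fun _ => key x⟩, forall_congr' fun x => ?_⟩
  rw [curl, key]
end

section
/- Let f : ℝ² → ℝ be of class C², let α₁, α₂, α₃ ∈ ℝ, let κ₂, κ₃, κ₄ : ℝ² → ℝ be arbitrary functions, and suppose that 1 + α₃ f₍;₂₂₎ + 2α₂ f₍;₁₂₎ + α₁ f₍;₁₁₎ ≠ 0 everywhere on ℝ²; define κ₁ = (−κ₂ f₍;₂₂₎ + κ₃ f₍;₁₂₎ − κ₄ f₍;₁₁₎)/(1 + α₃ f₍;₂₂₎ + 2α₂ f₍;₁₂₎ + α₁ f₍;₁₁₎). Let Ω, Ω' ⊆ ℝ² be open sets and let u = (u₁, u₂) : Ω → ℝ² be of class C¹ and satisfy on Ω the homogeneous nonlinear system u₂,₁ − u₁,₂ = 0 and κ₁(u)(u₁,₁u₂,₂ − u₁,₂²) + (α₃κ₁ + κ₂)(u)u₁,₁ + (−2α₂κ₁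 + κ₃)(u)u₁,₂ + (α₁κ₁ + κ₄)(u)u₂,₂ = 0. Define Φ : Ω → ℝ² by Φ(x₁, x₂) = (x₁ − f₍;₁₎(u(x)), x₂ − f₍;₂₎(u(x))), and suppose Φ is a bijection from Ω onto Ω' with differentiable inverse Ψ : Ω' → Ω. Then w := u ∘ Ψ = (w₁, w₂) satisfies on Ω' the autonomous homogeneous quasilinear system: w₂,₁ − w₁,₂ = 0 and (α₃κ₁ + κ₂)(w)w₁,₁ + (−2α₂κ₁ + κ₃)(w)w₁,₂ + (α₁κ₁ + κ₄)(w)w₂,₂ = 0. -/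
/-- The partial derivative `∂uₐ/∂xᵢ` of the `a`-th component of a map `ℝⁿ → ℝᵐ`. -/
noncomputable def pdc {n m : ℕ} (u : (Fin n → ℝ) → (Fin m → ℝ)) (a : Fin m) (i : Fin n)
    (x : Fin n → ℝ) : ℝ :=
  fderiv ℝ (fun y => u y a) x (Pi.single i 1)

theorem pdi_comp {n m : ℕ} {g : (Fin m → ℝ) → ℝ} {h : (Fin n → ℝ) → (Fin m → ℝ)}
    {z : Fin n → ℝ} (hg : DifferentiableAt ℝ g (h z)) (hh : DifferentiableAt ℝ h z) (i : Fin n) :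
    pdi (fun y => g (h y)) i z = ∑ a, pdi g a (h z) * pdc h a i z := by
  have hcomp : fderiv ℝ (fun y => g (h y)) z = (fderiv ℝ g (h z)).comp (fderiv ℝ h z) :=
    fderiv_comp z hg hh
  have hpdc : ∀ a, pdc h a i z = fderiv ℝ h z (Pi.single i 1) a := fun a => by
    rw [pdc, fderiv_apply hh a]
    rfl
  rw [pdi, hcomp, ContinuousLinearMap.comp_apply]
  conv_lhs => rw [pi_eq_sum_univ' (fderiv ℝ h z (Pi.single i 1)), map_sum]
  refine Finset.sum_congr rfl fun a _ => ?_
  rw [map_smul, smul_eq_mul, hpdc, mul_comm, pdi]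

theorem differentiable_pdi {n : ℕ} {f : (Fin n → ℝ) → ℝ} (hf : ContDiff ℝ 2 f) (i : Fin n) :
    Differentiable ℝ (pdi f i) :=
  ((hf.fderiv_right (m := 1) (by norm_num)).differentiable (by norm_num)).clm_apply
    (differentiable_const _)

theorem pdi_pdi_comm {n : ℕ} {f : (Fin n → ℝ) → ℝ} (hf : ContDiff ℝ 2 f) (i j : Fin n)
    (y : Fin n → ℝ) : pdi (pdi f i) j y = pdi (pdi f j) i y := by
  have hd : DifferentiableAt ℝ (fderiv ℝ f) y :=
    (hf.fderiv_right (m := 1) (by norm_num)).differentiable (by norm_num) y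
  have key : ∀ a b : Fin n, pdi (pdi f a) b y =
      fderiv ℝ (fderiv ℝ f) y (Pi.single b 1) (Pi.single a 1) := fun a b => by
    change fderiv ℝ (fun x => fderiv ℝ f x (Pi.single a 1)) y (Pi.single b 1) = _
    rw [fderiv_clm_apply hd (differentiableAt_const _)]
    simp
  rw [key, key]
  exact (hf.contDiffAt.isSymmSndFDerivAt (by simp)) _ _

/-- Here `U = !![p, q; q, r]`, `F = !![a, b; b, c]` and `M = !![m₀₀, m₀₁; m₁₀, m₁₁]` satisfy
`M = 1 + F * U * M`; the conclusion concerns the entries of `U * M`. -/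
theorem quasilinear_of_mongeAmpere {p q r a b c m₀₀ m₀₁ m₁₀ m₁₁ α₁ α₂ α₃ k₁ k₂ k₃ k₄ : ℝ}
    (h00 : m₀₀ = 1 + (a * (p * m₀₀ + q * m₁₀) + b * (q * m₀₀ + r * m₁₀)))
    (h01 : m₀₁ = 0 + (a * (p * m₀₁ + q * m₁₁) + b * (q * m₀₁ + r * m₁₁)))
    (h10 : m₁₀ = 0 + (b * (p * m₀₀ + q * m₁₀) + c * (q * m₀₀ + r * m₁₀)))
    (h11 : m₁₁ = 1 + (b * (p * m₀₁ + q * m₁₁) + c * (q * m₀₁ + r * m₁₁)))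
    (hκ : k₁ * (1 + α₃ * c + 2 * α₂ * b + α₁ * a) = -k₂ * c + k₃ * b - k₄ * a)
    (hMA : k₁ * (p * r - q ^ 2) + (α₃ * k₁ + k₂) * p + (-2 * α₂ * k₁ + k₃) * q +
      (α₁ * k₁ + k₄) * r = 0) :
    q * m₀₀ + r * m₁₀ - (p * m₀₁ + q * m₁₁) = 0 ∧
      (α₃ * k₁ + k₂) * (p * m₀₀ + q * m₁₀) + (-2 * α₂ * k₁ + k₃) * (p * m₀₁ + q * m₁₁) +
        (α₁ * k₁ + k₄) * (q * m₀₁ + r * m₁₁) = 0 := by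
  set A₀₀ := 1 - (a * p + b * q) with hA₀₀
  set A₀₁ := -(a * q + b * r) with hA₀₁
  set A₁₀ := -(b * p + c * q) with hA₁₀
  set A₁₁ := 1 - (b * q + c * r) with hA₁₁
  have e00 : A₀₀ * m₀₀ + A₀₁ * m₁₀ = 1 := by linear_combination h00
  have e01 : A₀₀ * m₀₁ + A₀₁ * m₁₁ = 0 := by linear_combination h01
  have e10 : A₁₀ * m₀₀ + A₁₁ * m₁₀ = 0 := by linear_combination h10
  have e11 : A₁₀ * m₀₁ + A₁₁ * m₁₁ = 1 := by linear_combination h11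
  set D := A₀₀ * A₁₁ - A₀₁ * A₁₀ with hD
  have hD0 : D ≠ 0 := by
    refine left_ne_zero_of_mul_eq_one (b := m₀₀ * m₁₁ - m₀₁ * m₁₀) ?_
    linear_combination (A₁₀ * m₀₁ + A₁₁ * m₁₁) * e00 + e11 - (A₁₀ * m₀₀ + A₁₁ * m₁₀) * e01
  have d00 : D * m₀₀ = A₁₁ := by linear_combination A₁₁ * e00 - A₀₁ * e10
  have d01 : D * m₀₁ = -A₀₁ := by linear_combination A₁₁ * e01 - A₀₁ * e11
  have d10 : D * m₁₀ = -A₁₀ := by linear_combination A₀₀ * e10 - A₁₀ * e00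
  have d11 : D * m₁₁ = A₀₀ := by linear_combination A₀₀ * e11 - A₁₀ * e01
  clear_value D
  constructor <;> refine (mul_eq_zero_iff_left hD0).1 ?_
  · linear_combination q * d00 + r * d10 - p * d01 - q * d11
  · linear_combination (α₃ * k₁ + k₂) * (p * d00 + q * d10) +
      (-2 * α₂ * k₁ + k₃) * (p * d01 + q * d11) + (α₁ * k₁ + k₄) * (q * d01 + r * d11) +
      hMA - (p * r - q ^ 2) * hκ

/-- Reduction of the homogeneous first-order Monge–Ampère system in
(1+1) dimensions to an autonomous homogeneous quasilinear system via the canonical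
variables `z₁ = x₁ − f₍;₁₎(u)`, `z₂ = x₂ − f₍;₂₎(u)`, `w = u`. -/
theorem stmt_10 (f : (Fin 2 → ℝ) → ℝ) (hf : ContDiff ℝ 2 f)
    (α₁ α₂ α₃ : ℝ) (κ₁ κ₂ κ₃ κ₄ : (Fin 2 → ℝ) → ℝ)
    (hden : ∀ y : Fin 2 → ℝ,
      1 + α₃ * pdi (pdi f 1) 1 y + 2 * α₂ * pdi (pdi f 0) 1 y + α₁ * pdi (pdi f 0) 0 y ≠ 0)
    (hκ₁ : κ₁ = fun y =>
      (-(κ₂ y) * pdi (pdi f 1) 1 y + κ₃ y * pdi (pdi f 0) 1 y - κ₄ y * pdi (pdi f 0) 0 y) /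
        (1 + α₃ * pdi (pdi f 1) 1 y + 2 * α₂ * pdi (pdi f 0) 1 y + α₁ * pdi (pdi f 0) 0 y))
    (Ω Ω' : Set (Fin 2 → ℝ)) (hΩ : IsOpen Ω) (hΩ' : IsOpen Ω')
    (u : (Fin 2 → ℝ) → (Fin 2 → ℝ)) (hu : ContDiffOn ℝ 1 u Ω)
    (hsys : ∀ x ∈ Ω,
      pdc u 1 0 x - pdc u 0 1 x = 0 ∧
      κ₁ (u x) * (pdc u 0 0 x * pdc u 1 1 x - (pdc u 0 1 x) ^ 2) +
        (α₃ * κ₁ (u x) + κ₂ (u x)) * pdc u 0 0 x +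
        (-2 * α₂ * κ₁ (u x) + κ₃ (u x)) * pdc u 0 1 x +
        (α₁ * κ₁ (u x) + κ₄ (u x)) * pdc u 1 1 x = 0)
    (Φ Ψ : (Fin 2 → ℝ) → (Fin 2 → ℝ))
    (hΦ : ∀ x, Φ x = fun j => x j - pdi f j (u x))
    (hbij : Set.BijOn Φ Ω Ω')
    (hΨΦ : ∀ x ∈ Ω, Ψ (Φ x) = x) (hΦΨ : ∀ z ∈ Ω', Φ (Ψ z) = z)
    (hΨmaps : Set.MapsTo Ψ Ω' Ω)
    (hΨdiff : ∀ z ∈ Ω', DifferentiableAt ℝ Ψ z) :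
    ∀ z ∈ Ω',
      pdc (u ∘ Ψ) 1 0 z - pdc (u ∘ Ψ) 0 1 z = 0 ∧
      (α₃ * κ₁ ((u ∘ Ψ) z) + κ₂ ((u ∘ Ψ) z)) * pdc (u ∘ Ψ) 0 0 z +
        (-2 * α₂ * κ₁ ((u ∘ Ψ) z) + κ₃ ((u ∘ Ψ) z)) * pdc (u ∘ Ψ) 0 1 z +
        (α₁ * κ₁ ((u ∘ Ψ) z) + κ₄ ((u ∘ Ψ) z)) * pdc (u ∘ Ψ) 1 1 z = 0 := by
  intro z hz
  obtain ⟨hsym, hMA⟩ := hsys (Ψ z) (hΨmaps hz)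
  have hud : DifferentiableAt ℝ u (Ψ z) :=
    (hu.differentiableOn (by norm_num)).differentiableAt (hΩ.mem_nhds (hΨmaps hz))
  have hwd : DifferentiableAt ℝ (u ∘ Ψ) z := hud.comp z (hΨdiff z hz)
  have hW : ∀ a i, pdc (u ∘ Ψ) a i z =
      pdc u a 0 (Ψ z) * pdc Ψ 0 i z + pdc u a 1 (Ψ z) * pdc Ψ 1 i z := fun a i => by
    have h := pdi_comp (g := fun y => u y a) (differentiableAt_pi.1 hud a) (hΨdiff z hz) i
    rw [Fin.sum_univ_two] at h
    exact h
  have hM : ∀ j i, pdc Ψ j i z = (Pi.single i 1 : Fin 2 → ℝ) j +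
      (pdi (pdi f j) 0 (u (Ψ z)) * pdc (u ∘ Ψ) 0 i z +
        pdi (pdi f j) 1 (u (Ψ z)) * pdc (u ∘ Ψ) 1 i z) := fun j i => by
    have hfj : DifferentiableAt ℝ (pdi f j) ((u ∘ Ψ) z) := differentiable_pdi hf j _
    have h := pdi_comp hfj hwd i
    rw [Fin.sum_univ_two] at h
    have heq : (fun y => Ψ y j) =ᶠ[nhds z] fun y => y j + pdi f j ((u ∘ Ψ) y) := by
      filter_upwards [hΩ'.mem_nhds hz] with y hy
      have := congrFun ((hΦ (Ψ y)).symm.trans (hΦΨ y hy)) j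
      simp only [Function.comp_apply]
      linarith
    have hadd : fderiv ℝ (fun y => y j + pdi f j ((u ∘ Ψ) y)) z =
        fderiv ℝ (fun y : Fin 2 → ℝ => y j) z + fderiv ℝ (fun y => pdi f j ((u ∘ Ψ) y)) z :=
      fderiv_fun_add (differentiableAt_apply j z) (hfj.comp z hwd)
    have hproj : fderiv ℝ (fun y : Fin 2 → ℝ => y j) z = ContinuousLinearMap.proj j :=
      (ContinuousLinearMap.proj (R := ℝ) (φ := fun _ : Fin 2 => ℝ) j).fderiv
    rw [pdc, heq.fderiv_eq, hadd, hproj]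
    exact congrArg ((Pi.single i 1 : Fin 2 → ℝ) j + ·) h
  have hF := pdi_pdi_comm hf 1 0 (u (Ψ z))
  have hκ : κ₁ (u (Ψ z)) * _ = _ := (eq_div_iff (hden (u (Ψ z)))).1 (congrFun hκ₁ (u (Ψ z)))
  have h00 := hM 0 0
  have h01 := hM 0 1
  have h10 := hM 1 0
  have h11 := hM 1 1
  rw [hF] at h10 h11
  simp only [Pi.single_eq_same, ne_eq, zero_ne_one, one_ne_zero, not_false_eq_true,
    Pi.single_eq_of_ne] at h00 h01 h10 h11
  rw [hW 0, hW 1, sub_eq_zero.1 hsym] at h00 h01 h10 h11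
  simp only [hW, sub_eq_zero.1 hsym, Function.comp_apply]
  exact quasilinear_of_mongeAmpere h00 h01 h10 h11 hκ hMA
end
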